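/- Let r : ℝ^d → ℝ be differentiable, μ-strongly convex and μ'-smooth, and let η ≥ 0. Let y₁,…,y_n, g₁,…,g_n ∈ ℝ^d and x̄, ḡ ∈ ℝ^d, and let u₁,…,u_n, v ∈ ℝ^d satisfy ∇r(u_i) = ∇r(y_i) − η·g_i for each i and ∇r(v) = ∇r(x̄) − η·ḡ. Then ‖(1/n)·Σ_{i=1}^n u_i − v‖ ≤ (μ'/(n·μ))·Σ_{i=1}^n ‖y_i − x̄‖ + (η/(n·μ))·Σ_{i=1}^n ‖g_i − ḡ‖. -/

import Mathlib

open RealInnerProductSpace Finset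

/-- `h'` is the gradient of `h` at every point. -/
def HasGradFn {d : ℕ} (h : EuclideanSpace ℝ (Fin d) → ℝ)
    (h' : EuclideanSpace ℝ (Fin d) → EuclideanSpace ℝ (Fin d)) : Prop :=
  ∀ x, HasGradientAt h (h' x) x

/-- `h` is `c`-strongly convex with gradient `h'`. -/
def StrongConvexGrad {d : ℕ} (c : ℝ) (h : EuclideanSpace ℝ (Fin d) → ℝ)
    (h' : EuclideanSpace ℝ (Fin d) → EuclideanSpace ℝ (Fin d)) : Prop :=
  ∀ x y, h x + ⟪h' x, y - x⟫ + c / 2 * ‖y - x‖ ^ 2 ≤ h y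

/-- `h` is `c`-smooth with gradient `h'`. -/
def SmoothGrad {d : ℕ} (c : ℝ) (h : EuclideanSpace ℝ (Fin d) → ℝ)
    (h' : EuclideanSpace ℝ (Fin d) → EuclideanSpace ℝ (Fin d)) : Prop :=
  ∀ x y, h y ≤ h x + ⟪h' x, y - x⟫ + c / 2 * ‖y - x‖ ^ 2

/-- Bregman divergence `D_r(x, y)` of `r` with gradient `r'`. -/
noncomputable def bregman {d : ℕ} (r : EuclideanSpace ℝ (Fin d) → ℝ)
    (r' : EuclideanSpace ℝ (Fin d) → EuclideanSpace ℝ (Fin d))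
    (x y : EuclideanSpace ℝ (Fin d)) : ℝ :=
  r x - r y - ⟪r' y, x - y⟫

theorem StrongConvexGrad.mul_norm_sub_le {d : ℕ} {h : EuclideanSpace ℝ (Fin d) → ℝ}
    {h' : EuclideanSpace ℝ (Fin d) → EuclideanSpace ℝ (Fin d)} {c : ℝ}
    (hc : StrongConvexGrad c h h') (x y : EuclideanSpace ℝ (Fin d)) :
    c * ‖x - y‖ ≤ ‖h' x - h' y‖ := by
  rcases eq_or_ne x y with rfl | hxy
  · simp
  have hpos : 0 < ‖x - y‖ := norm_pos_iff.2 (sub_ne_zero.2 hxy)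
  have h1 := hc x y
  have h2 := hc y x
  have h3 := real_inner_le_norm (h' x - h' y) (x - y)
  rw [← neg_sub x y, inner_neg_right, norm_neg] at h1
  rw [inner_sub_left] at h3
  refine le_of_mul_le_mul_right ?_ hpos
  linarith

theorem StrongConvexGrad.le_of_smoothGrad {d : ℕ} {h : EuclideanSpace ℝ (Fin d) → ℝ}
    {h' : EuclideanSpace ℝ (Fin d) → EuclideanSpace ℝ (Fin d)} {c L : ℝ}
    (hc : StrongConvexGrad c h h') (hL : SmoothGrad L h h')
    {x y : EuclideanSpace ℝ (Fin d)} (hxy : x ≠ y) : c ≤ L := by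
  have hpos : 0 < ‖y - x‖ ^ 2 := pow_pos (norm_pos_iff.2 (sub_ne_zero.2 hxy.symm)) 2
  have h1 := hc x y
  have h2 := hL x y
  refine le_of_mul_le_mul_right ?_ hpos
  linarith

/-- A convex `L`-smooth function exceeds its tangent planes by at least the squared gradient
difference divided by `2 * L`. -/
theorem SmoothGrad.norm_grad_sub_sq_div_le {d : ℕ} {h : EuclideanSpace ℝ (Fin d) → ℝ}
    {h' : EuclideanSpace ℝ (Fin d) → EuclideanSpace ℝ (Fin d)} {c L : ℝ}
    (hL : SmoothGrad L h h') (hc : StrongConvexGrad c h h') (hc0 : 0 ≤ c) (hL0 : 0 < L)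
    (x y : EuclideanSpace ℝ (Fin d)) :
    h x + ⟪h' x, y - x⟫ + ‖h' y - h' x‖ ^ 2 / (2 * L) ≤ h y := by
  set G := h' y - h' x with hG
  have h1 := hc x (y - L⁻¹ • G)
  have h2 := hL y (y - L⁻¹ • G)
  have h3 : 0 ≤ c / 2 * ‖y - L⁻¹ • G - x‖ ^ 2 := by positivity
  have h4 : ⟪h' y, G⟫ - ⟪h' x, G⟫ = ‖G‖ ^ 2 := by
    rw [← inner_sub_left, ← hG, real_inner_self_eq_norm_sq]
  have h5 : L / 2 * (L⁻¹ * ‖G‖) ^ 2 = ‖G‖ ^ 2 / (2 * L) := by field_simp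
  have h6 : L⁻¹ * ‖G‖ ^ 2 = 2 * (‖G‖ ^ 2 / (2 * L)) := by field_simp
  rw [sub_right_comm y _ x, inner_sub_right, real_inner_smul_right, sub_right_comm y x] at h1
  rw [sub_sub_cancel_left, inner_neg_right, real_inner_smul_right, norm_neg, norm_smul,
    Real.norm_of_nonneg (inv_nonneg.2 hL0.le), h5] at h2
  rw [← h4, mul_sub, h4] at h6
  linarith

theorem SmoothGrad.norm_grad_sub_le {d : ℕ} {h : EuclideanSpace ℝ (Fin d) → ℝ}
    {h' : EuclideanSpace ℝ (Fin d) → EuclideanSpace ℝ (Fin d)} {c L : ℝ}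
    (hL : SmoothGrad L h h') (hc : StrongConvexGrad c h h') (hc0 : 0 < c)
    (x y : EuclideanSpace ℝ (Fin d)) :
    ‖h' x - h' y‖ ≤ L * ‖x - y‖ := by
  rcases eq_or_ne x y with rfl | hxy
  · simp
  have hL0 : 0 < L := hc0.trans_le (hc.le_of_smoothGrad hL hxy)
  have h1 := hL.norm_grad_sub_sq_div_le hc hc0.le hL0 x y
  have h2 := hL.norm_grad_sub_sq_div_le hc hc0.le hL0 y x
  have h3 := real_inner_le_norm (h' x - h' y) (x - y)
  rw [← neg_sub x y, inner_neg_right, norm_sub_rev] at h1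
  rw [inner_sub_left] at h3
  have h4 : ‖h' x - h' y‖ ^ 2 = L * (2 * (‖h' x - h' y‖ ^ 2 / (2 * L))) := by field_simp
  have h5 : ‖h' x - h' y‖ ^ 2 ≤ L * (‖h' x - h' y‖ * ‖x - y‖) := by
    rw [h4]
    exact mul_le_mul_of_nonneg_left (by linarith) hL0.le
  rcases (norm_nonneg (h' x - h' y)).eq_or_lt with h0 | h0
  · rw [← h0]
    positivity
  · refine le_of_mul_le_mul_right ?_ h0
    linarith

/-- The averaged form of the network-error bound (equation (21)) in the proof of
Theorem 1. -/
theorem averaged_mirror_map_perturbation_bound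
    {d n : ℕ} (hn : 0 < n)
    (r : EuclideanSpace ℝ (Fin d) → ℝ)
    (r' : EuclideanSpace ℝ (Fin d) → EuclideanSpace ℝ (Fin d))
    (hrdiff : HasGradFn r r')
    (mu mu' eta : ℝ) (hmu : 0 < mu)
    (hrsc : StrongConvexGrad mu r r') (hrsm : SmoothGrad mu' r r')
    (heta : 0 ≤ eta)
    (y g : Fin n → EuclideanSpace ℝ (Fin d))
    (xbar gbar : EuclideanSpace ℝ (Fin d))
    (u : Fin n → EuclideanSpace ℝ (Fin d)) (v : EuclideanSpace ℝ (Fin d))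
    (hu : ∀ i, r' (u i) = r' (y i) - eta • g i)
    (hv : r' v = r' xbar - eta • gbar) :
    ‖(1 / (n : ℝ)) • ∑ i, u i - v‖ ≤
      mu' / ((n : ℝ) * mu) * ∑ i, ‖y i - xbar‖
        + eta / ((n : ℝ) * mu) * ∑ i, ‖g i - gbar‖ := by
  have hn' : (0 : ℝ) < n := by exact_mod_cast hn
  have key : ∀ i, ‖u i - v‖ ≤ (mu' * ‖y i - xbar‖ + eta * ‖g i - gbar‖) / mu := by
    intro i
    rw [le_div_iff₀' hmu]
    calc mu * ‖u i - v‖ ≤ ‖r' (u i) - r' v‖ := hrsc.mul_norm_sub_le _ _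
      _ = ‖(r' (y i) - r' xbar) - eta • (g i - gbar)‖ := by
        rw [hu, hv, smul_sub, sub_sub_sub_comm]
      _ ≤ ‖r' (y i) - r' xbar‖ + ‖eta • (g i - gbar)‖ := norm_sub_le _ _
      _ ≤ mu' * ‖y i - xbar‖ + eta * ‖g i - gbar‖ := by
        rw [norm_smul, Real.norm_of_nonneg heta]
        gcongr
        exact hrsm.norm_grad_sub_le hrsc hmu _ _
  have hmean : (1 / (n : ℝ)) • ∑ i, u i - v = (1 / (n : ℝ)) • ∑ i, (u i - v) := by
    rw [sum_sub_distrib, sum_const, card_univ, Fintype.card_fin, smul_sub,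
      ← Nat.cast_smul_eq_nsmul ℝ, smul_smul, one_div_mul_cancel hn'.ne', one_smul]
  rw [hmean, norm_smul, Real.norm_of_nonneg (by positivity)]
  calc 1 / (n : ℝ) * ‖∑ i, (u i - v)‖
      ≤ 1 / (n : ℝ) * ∑ i, (mu' * ‖y i - xbar‖ + eta * ‖g i - gbar‖) / mu := by
        gcongr
        exact norm_sum_le_of_le _ fun i _ => key i
    _ = _ := by
        rw [← sum_div, sum_add_distrib, ← mul_sum, ← mul_sum]
        field_simp
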